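/- arXiv:2005.11141 — 8 statements merged into one kernel-verified Lean document; each statement's English description precedes it below -/
import Mathlib

section
/- Let s : ℝⁿ → ℝ be smooth and define the geomentum operator components p̂ⱼ f = −iℏ(∂ⱼf + (∂ⱼs)·f) acting on smooth functions f : ℝⁿ → ℂ, and let x̂ᵢ denote multiplication by the i-th coordinate. Then the quantum covariant Poisson bracket satisfies the geometric canonical commutation relation [x̂ᵢ, p̂ⱼ] = iℏ(δᵢⱼ + xᵢ·∂ⱼs), i.e. for every smooth f : ℝⁿ → ℂ and every point x ∈ ℝⁿ, ([x̂ᵢ, p̂ⱼ]f)(x) = iℏ(δᵢⱼ + xᵢ ∂ⱼs(x)) f(x). -/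
noncomputable section
open Complex

/-- Euclidean space `ℝⁿ`. -/
abbrev En (n : ℕ) : Type := EuclideanSpace ℝ (Fin n)

/-- `j`-th partial derivative of a real-valued function. -/
def pdR {n : ℕ} (s : En n → ℝ) (j : Fin n) (x : En n) : ℝ :=
  fderiv ℝ s x (EuclideanSpace.single j 1)

/-- `j`-th partial derivative of a complex-valued function. -/
def pdC {n : ℕ} (f : En n → ℂ) (j : Fin n) (x : En n) : ℂ :=
  fderiv ℝ f x (EuclideanSpace.single j 1)

/-- Operators acting on functions `ℝⁿ → ℂ`. -/
abbrev Opn (n : ℕ) : Type := (En n → ℂ) → (En n → ℂ)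

/-- Multiplication operator by a real-valued function. -/
def mulOpn {n : ℕ} (g : En n → ℝ) : Opn n := fun f x => (g x : ℂ) * f x

/-- Quantum Poisson bracket `[A,B]_QPB = A∘B − B∘A`. -/
def QPBn {n : ℕ} (A B : Opn n) : Opn n := fun f => A (B f) - B (A f)

/-- Quantum covariant Poisson bracket
`[A,B] = [A,B]_QPB + A∘[s,B]_QPB − B∘[s,A]_QPB`. -/
def QCPBn {n : ℕ} (s : En n → ℝ) (A B : Opn n) : Opn n :=
  fun f => QPBn A B f + A (QPBn (mulOpn s) B f) - B (QPBn (mulOpn s) A f)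

/-- Position operator: multiplication by the `i`-th coordinate. -/
def xhatn {n : ℕ} (i : Fin n) : Opn n := fun f x => (x i : ℂ) * f x

/-- Geomentum operator component `p̂ⱼ f = −iℏ(∂ⱼf + (∂ⱼs)·f)`. -/
def phatn {n : ℕ} (ℏ : ℝ) (s : En n → ℝ) (j : Fin n) : Opn n := fun f x =>
  -Complex.I * (ℏ : ℂ) * (pdC f j x + (pdR s j x : ℂ) * f x)

theorem pdC_mulOpn {n : ℕ} {g : En n → ℝ} {f : En n → ℂ} {x : En n}
    (hg : DifferentiableAt ℝ g x) (hf : DifferentiableAt ℝ f x) (j : Fin n) :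
    pdC (mulOpn g f) j x = (g x : ℂ) * pdC f j x + (pdR g j x : ℂ) * f x := by
  have h := hg.hasFDerivAt.smul hf.hasFDerivAt
  have e : mulOpn g f = g • f := by
    funext y
    simp [mulOpn]
  unfold pdC pdR
  rw [e, h.fderiv]
  simp

theorem pdR_coord {n : ℕ} (i j : Fin n) (x : En n) :
    pdR (fun y : En n => y i) j x = if i = j then 1 else 0 := by
  have h : HasFDerivAt (fun y : En n => y i) (EuclideanSpace.proj i : En n →L[ℝ] ℝ) x :=
    (EuclideanSpace.proj i : En n →L[ℝ] ℝ).hasFDerivAt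
  unfold pdR
  rw [h.fderiv]
  simp

/-- The bracket of multiplication by `g` with the geomentum operator is `iℏ ∂ⱼg`. -/
theorem QPBn_mulOpn_phatn {n : ℕ} (ℏ : ℝ) (s : En n → ℝ) {g : En n → ℝ} {f : En n → ℂ}
    {x : En n} (hg : DifferentiableAt ℝ g x) (hf : DifferentiableAt ℝ f x) (j : Fin n) :
    QPBn (mulOpn g) (phatn ℏ s j) f x = Complex.I * (ℏ : ℂ) * (pdR g j x : ℂ) * f x := by
  simp only [QPBn, phatn, Pi.sub_apply, pdC_mulOpn hg hf]
  simp only [mulOpn, phatn]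
  ring

theorem QPBn_mulOpn_xhatn {n : ℕ} (s : En n → ℝ) (i : Fin n) (f : En n → ℂ) :
    QPBn (mulOpn s) (xhatn i) f = 0 := by
  funext x
  simp only [QPBn, mulOpn, xhatn, Pi.sub_apply, Pi.zero_apply]
  ring

theorem phatn_zero {n : ℕ} (ℏ : ℝ) (s : En n → ℝ) (j : Fin n) : phatn ℏ s j 0 = 0 := by
  funext x
  simp [phatn, pdC]

/-- Geometric canonical commutation relation:
`[x̂ᵢ, p̂ⱼ] = iℏ(δᵢⱼ + xᵢ·∂ⱼs)` for the QCPB. -/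
theorem geometric_canonical_commutation (n : ℕ) (ℏ : ℝ) (hℏ : 0 < ℏ)
    (s : En n → ℝ) (hs : ContDiff ℝ (⊤ : ℕ∞) s) (i j : Fin n) :
    ∀ f : En n → ℂ, ContDiff ℝ (⊤ : ℕ∞) f → ∀ x : En n,
      QCPBn s (xhatn i) (phatn ℏ s j) f x
        = Complex.I * (ℏ : ℂ) *
            ((if i = j then (1 : ℂ) else 0) + (x i : ℂ) * (pdR s j x : ℂ)) * f x := by
  intro f hf x
  have hfx : DifferentiableAt ℝ f x := hf.differentiable (by simp) x
  have hsx : DifferentiableAt ℝ s x := hs.differentiable (by simp) x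
  have hix : DifferentiableAt ℝ (fun y : En n => y i) x :=
    (EuclideanSpace.proj i : En n →L[ℝ] ℝ).differentiableAt
  have hcoord : xhatn i = mulOpn (fun y : En n => y i) := rfl
  have h : QCPBn s (xhatn i) (phatn ℏ s j) f x
      = QPBn (xhatn i) (phatn ℏ s j) f x
        + (x i : ℂ) * QPBn (mulOpn s) (phatn ℏ s j) f x := by
    simp [QCPBn, QPBn_mulOpn_xhatn, phatn_zero, xhatn]
  rw [h, hcoord, QPBn_mulOpn_phatn ℏ s hix hfx, QPBn_mulOpn_phatn ℏ s hsx hfx, pdR_coord]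
  split_ifs <;> push_cast <;> ring
end
end

section
/- The quantum covariant Poisson bracket of the annihilation and creation operators equals multiplication by 1 + x·u: for every smooth f : ℝ → ℂ and x ∈ ℝ, ([a, a†]f)(x) = (1 + x·u(x))·f(x), where [·,·] is the QCPB with structural function s. -/
noncomputable section
open Complex

/-- Operators acting on functions `ℝ → ℂ`. -/
abbrev Op : Type := (ℝ → ℂ) → (ℝ → ℂ)

/-- Multiplication operator by a real-valued function. -/
def mulOp (g : ℝ → ℝ) : Op := fun f x => (g x : ℂ) * f x

/-- Quantum Poisson bracket `[A,B]_QPB = A∘B − B∘A`. -/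
def QPB (A B : Op) : Op := fun f => A (B f) - B (A f)

/-- Quantum covariant Poisson bracket
`[A,B] = [A,B]_QPB + A∘[s,B]_QPB − B∘[s,A]_QPB`. -/
def QCPB (s : ℝ → ℝ) (A B : Op) : Op :=
  fun f => QPB A B f + A (QPB (mulOp s) B f) - B (QPB (mulOp s) A f)

/-- Position (multiplication by `x`). -/
def xhat : Op := fun f x => (x : ℂ) * f x

/-- Classical momentum operator `p̂⁽ᶜˡ⁾ f = −iℏ f'`. -/
def pcl (ℏ : ℝ) : Op := fun f x => -Complex.I * (ℏ : ℂ) * deriv f x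

/-- Classical harmonic-oscillator Hamiltonian. -/
def Hcl (ℏ m ω : ℝ) : Op := fun f x =>
  -((ℏ : ℂ) ^ 2 / (2 * (m : ℂ))) * deriv (deriv f) x
    + ((m : ℂ) * (ω : ℂ) ^ 2 / 2) * (x : ℂ) ^ 2 * f x

/-- Geomentum operator `p̂⁽ʳⁱ⁾ f = −iℏ (f' + u f)` with `u = s'`. -/
def pri (ℏ : ℝ) (s : ℝ → ℝ) : Op := fun f x =>
  -Complex.I * (ℏ : ℂ) * (deriv f x + ((deriv s x : ℝ) : ℂ) * f x)

/-- Ri-operator Hamiltonian `Ĥ⁽ʳⁱ⁾ = (1/2m) p̂⁽ʳⁱ⁾∘p̂⁽ʳⁱ⁾ + (mω²/2)x²`. -/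
def Hri (ℏ m ω : ℝ) (s : ℝ → ℝ) : Op := fun f x =>
  (1 / (2 * (m : ℂ))) * pri ℏ s (pri ℏ s f) x
    + ((m : ℂ) * (ω : ℂ) ^ 2 / 2) * (x : ℂ) ^ 2 * f x

/-- G-dynamics operator `ŵ⁽ᶜˡ⁾ f = −(iℏ/2m)(2u f' + u' f)`. -/
def wcl (ℏ m : ℝ) (s : ℝ → ℝ) : Op := fun f x =>
  -(Complex.I * (ℏ : ℂ) / (2 * (m : ℂ))) *
    (2 * ((deriv s x : ℝ) : ℂ) * deriv f x + ((deriv (deriv s) x : ℝ) : ℂ) * f x)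

/-- Ri G-dynamics operator `ŵ⁽ʳⁱ⁾ f = −(iℏ/2m)(2u f' + u' f + 2u² f)`. -/
def wri (ℏ m : ℝ) (s : ℝ → ℝ) : Op := fun f x =>
  -(Complex.I * (ℏ : ℂ) / (2 * (m : ℂ))) *
    (2 * ((deriv s x : ℝ) : ℂ) * deriv f x + ((deriv (deriv s) x : ℝ) : ℂ) * f x
      + 2 * ((deriv s x : ℝ) : ℂ) ^ 2 * f x)

/-- Annihilation operator. -/
def aOp (ℏ m ω : ℝ) : Op := fun f x =>
  (Real.sqrt (m * ω / (2 * ℏ)) : ℂ) *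
    ((x : ℂ) * f x + ((ℏ : ℂ) / ((m : ℂ) * (ω : ℂ))) * deriv f x)

/-- Creation operator. -/
def adOp (ℏ m ω : ℝ) : Op := fun f x =>
  (Real.sqrt (m * ω / (2 * ℏ)) : ℂ) *
    ((x : ℂ) * f x - ((ℏ : ℂ) / ((m : ℂ) * (ω : ℂ))) * deriv f x)

/-- `b`: multiplication by `√(ℏ/2mω)·u`. -/
def bOp (ℏ m ω : ℝ) (s : ℝ → ℝ) : Op :=
  mulOp (fun x => Real.sqrt (ℏ / (2 * m * ω)) * deriv s x)

/-- Number operator `N̂ = a†∘a`. -/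
def NOp (ℏ m ω : ℝ) : Op := fun f => adOp ℏ m ω (aOp ℏ m ω f)

/-- `N̂⁽ᶜᵍ⁾ = −(i/ω)·ŵ⁽ᶜˡ⁾`. -/
def Ncg (ℏ m ω : ℝ) (s : ℝ → ℝ) : Op := fun f x =>
  -(Complex.I / (ω : ℂ)) * wcl ℏ m s f x

/-- Geometric annihilation operator `a⁽ˢ⁾ = a + b`. -/
def asOp (ℏ m ω : ℝ) (s : ℝ → ℝ) : Op := fun f x =>
  aOp ℏ m ω f x + bOp ℏ m ω s f x

/-- Geometric creation operator `a⁽ˢ⁾† = a† − b`. -/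
def adsOp (ℏ m ω : ℝ) (s : ℝ → ℝ) : Op := fun f x =>
  adOp ℏ m ω f x - bOp ℏ m ω s f x

/-- For a differentiable `f`, the commutator `[s, a]` is multiplication by `-√(mω/2ℏ) (ℏ/mω) u`,
where `u` is the derivative of `s`. -/
lemma QPB_mulOp_aOp (ℏ m ω : ℝ) {s : ℝ → ℝ} {f : ℝ → ℂ} (hs : Differentiable ℝ s)
    (hf : Differentiable ℝ f) :
    QPB (mulOp s) (aOp ℏ m ω) f = fun x =>
      -((Real.sqrt (m * ω / (2 * ℏ)) : ℂ) * ((ℏ : ℂ) / ((m : ℂ) * (ω : ℂ))) *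
        (((deriv s x : ℝ) : ℂ) * f x)) := by
  funext x
  have h : deriv (mulOp s f) x = ((deriv s x : ℝ) : ℂ) * f x + s x * deriv f x :=
    ((hs x).hasDerivAt.ofReal_comp.fun_mul (hf x).hasDerivAt).deriv
  simp only [QPB, aOp, Pi.sub_apply, h]
  simp only [mulOp, aOp]
  ring

/-- For a differentiable `f`, the commutator `[s, a†]` is multiplication by `√(mω/2ℏ) (ℏ/mω) u`,
where `u` is the derivative of `s`. -/
lemma QPB_mulOp_adOp (ℏ m ω : ℝ) {s : ℝ → ℝ} {f : ℝ → ℂ} (hs : Differentiable ℝ s)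
    (hf : Differentiable ℝ f) :
    QPB (mulOp s) (adOp ℏ m ω) f = fun x =>
      (Real.sqrt (m * ω / (2 * ℏ)) : ℂ) * ((ℏ : ℂ) / ((m : ℂ) * (ω : ℂ))) *
        (((deriv s x : ℝ) : ℂ) * f x) := by
  funext x
  have h : deriv (mulOp s f) x = ((deriv s x : ℝ) : ℂ) * f x + s x * deriv f x :=
    ((hs x).hasDerivAt.ofReal_comp.fun_mul (hf x).hasDerivAt).deriv
  simp only [QPB, adOp, Pi.sub_apply, h]
  simp only [mulOp, adOp]
  ring

/-- The normalisation of the ladder operators: `(√(mω/2ℏ))² (ℏ/mω) = 1/2`. -/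
lemma sqrt_sq_mul_div_eq_half {ℏ m ω : ℝ} (hℏ : 0 < ℏ) (hm : 0 < m) (hω : 0 < ω) :
    (Real.sqrt (m * ω / (2 * ℏ)) : ℂ) ^ 2 * ((ℏ : ℂ) / ((m : ℂ) * (ω : ℂ))) = 1 / 2 := by
  have h : Real.sqrt (m * ω / (2 * ℏ)) ^ 2 * (ℏ / (m * ω)) = 1 / 2 := by
    rw [Real.sq_sqrt (by positivity)]
    field_simp
  simpa using congrArg (fun r : ℝ => (r : ℂ)) h

/-- The canonical commutation relation `[a, a†] = 1`. -/
lemma QPB_aOp_adOp {ℏ m ω : ℝ} (hℏ : 0 < ℏ) (hm : 0 < m) (hω : 0 < ω) {f : ℝ → ℂ}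
    (hf : Differentiable ℝ f) (hf' : Differentiable ℝ (deriv f)) :
    QPB (aOp ℏ m ω) (adOp ℏ m ω) f = f := by
  funext x
  have hx : HasDerivAt (fun y : ℝ => (y : ℂ) * f y) (1 * f x + x * deriv f x) x := by
    simpa using (hasDerivAt_id' x).ofReal_comp.fun_mul (hf x).hasDerivAt
  have hk := (hf' x).hasDerivAt.const_mul ((ℏ : ℂ) / ((m : ℂ) * (ω : ℂ)))
  have ha : deriv (aOp ℏ m ω f) x = _ :=
    ((hx.add hk).const_mul (Real.sqrt (m * ω / (2 * ℏ)) : ℂ)).deriv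
  have had : deriv (adOp ℏ m ω f) x = _ :=
    ((hx.sub hk).const_mul (Real.sqrt (m * ω / (2 * ℏ)) : ℂ)).deriv
  change √(m * ω / (2 * ℏ)) * (x * adOp ℏ m ω f x + ℏ / (m * ω) * deriv (adOp ℏ m ω f) x) -
    √(m * ω / (2 * ℏ)) * (x * aOp ℏ m ω f x - ℏ / (m * ω) * deriv (aOp ℏ m ω f) x) = f x
  rw [ha, had]
  simp only [aOp, adOp]
  linear_combination 2 * f x * sqrt_sq_mul_div_eq_half hℏ hm hω

/-- The QCPB of the annihilation and creation operators equals
multiplication by `1 + x·u`. -/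
theorem qcpb_a_adagger (ℏ m ω : ℝ) (hℏ : 0 < ℏ) (hm : 0 < m) (hω : 0 < ω)
    (s : ℝ → ℝ) (hs : ContDiff ℝ (⊤ : ℕ∞) s) :
    ∀ f : ℝ → ℂ, ContDiff ℝ (⊤ : ℕ∞) f → ∀ x : ℝ,
      QCPB s (aOp ℏ m ω) (adOp ℏ m ω) f x
        = (1 + (x : ℂ) * ((deriv s x : ℝ) : ℂ)) * f x := by
  intro f hf x
  have hs' : Differentiable ℝ s := hs.differentiable (by simp)
  have hf' : Differentiable ℝ f := hf.differentiable (by simp)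
  have hf'' : Differentiable ℝ (deriv f) :=
    (contDiff_infty.1 hf 2).differentiable_deriv_two
  simp only [QCPB, QPB_aOp_adOp hℏ hm hω hf' hf'', QPB_mulOp_aOp ℏ m ω hs' hf',
    QPB_mulOp_adOp ℏ m ω hs' hf', Pi.add_apply, Pi.sub_apply, aOp, adOp, deriv.fun_neg]
  linear_combination 2 * (x : ℂ) * ((deriv s x : ℝ) : ℂ) * f x * sqrt_sq_mul_div_eq_half hℏ hm hω
end
end

section
/- The G-dynamics of the Ri-operator Hamiltonian is ŵ^(ri) = −(iℏ/2m)(2u·d/dx + u' + 2u²): for every smooth f : ℝ → ℂ, (1/(iℏ))·[s, Ĥ^(ri)]_QPB f = −(iℏ/2m)(2u f' + u' f + 2u² f). -/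
noncomputable section
open Complex

/-- Leibniz rule for the geomentum operator: `p̂(g f) = g p̂ f − iℏ g' f`. -/
theorem pri_mulOp (ℏ : ℝ) (s : ℝ → ℝ) {g : ℝ → ℝ} {f : ℝ → ℂ}
    (hg : Differentiable ℝ g) (hf : Differentiable ℝ f) :
    pri ℏ s (mulOp g f) = mulOp g (pri ℏ s f) + (-I * (ℏ : ℂ)) • mulOp (deriv g) f := by
  funext x
  have h : deriv (mulOp g f) x = ((deriv g x : ℝ) : ℂ) * f x + (g x : ℂ) * deriv f x :=
    ((hg x).hasDerivAt.ofReal_comp.mul (hf x).hasDerivAt).deriv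
  simp only [pri, Pi.add_apply, Pi.smul_apply, smul_eq_mul, h]
  simp only [mulOp, pri]
  ring

/-- The geomentum operator is linear on differentiable functions. -/
theorem pri_add_smul (ℏ : ℝ) (s : ℝ → ℝ) (c : ℂ) {f g : ℝ → ℂ}
    (hf : Differentiable ℝ f) (hg : Differentiable ℝ g) :
    pri ℏ s (f + c • g) = pri ℏ s f + c • pri ℏ s g := by
  funext x
  have h : deriv (f + c • g) x = deriv f x + c * deriv g x :=
    ((hf x).hasDerivAt.add ((hg x).hasDerivAt.const_smul c)).deriv
  simp only [pri, Pi.add_apply, Pi.smul_apply, smul_eq_mul, h]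
  ring

/-- Multiplication by a differentiable function preserves differentiability. -/
theorem differentiable_mulOp {g : ℝ → ℝ} {f : ℝ → ℂ}
    (hg : Differentiable ℝ g) (hf : Differentiable ℝ f) : Differentiable ℝ (mulOp g f) :=
  fun x => ((hg x).hasDerivAt.ofReal_comp.mul (hf x).hasDerivAt).differentiableAt

/-- The G-dynamics of the Ri-operator Hamiltonian:
`(1/(iℏ))·[s, Ĥ⁽ʳⁱ⁾]_QPB f = −(iℏ/2m)(2u f' + u' f + 2u² f)`. -/
theorem gdynamics_ri (ℏ m ω : ℝ) (hℏ : 0 < ℏ) (hm : 0 < m) (hω : 0 < ω)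
    (s : ℝ → ℝ) (hs : ContDiff ℝ (⊤ : ℕ∞) s) :
    ∀ f : ℝ → ℂ, ContDiff ℝ (⊤ : ℕ∞) f → ∀ x : ℝ,
      (1 / (Complex.I * (ℏ : ℂ))) * QPB (mulOp s) (Hri ℏ m ω s) f x
        = -(Complex.I * (ℏ : ℂ) / (2 * (m : ℂ))) *
            (2 * ((deriv s x : ℝ) : ℂ) * deriv f x + ((deriv (deriv s) x : ℝ) : ℂ) * f x
              + 2 * ((deriv s x : ℝ) : ℂ) ^ 2 * f x) := by
  intro f hf x
  have hds : Differentiable ℝ s := hs.differentiable (by simp)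
  have hdu : Differentiable ℝ (deriv s) :=
    (contDiff_infty_iff_deriv.1 hs).2.differentiable (by simp)
  have hdf : Differentiable ℝ f := hf.differentiable (by simp)
  have hdf' : Differentiable ℝ (deriv f) :=
    (contDiff_infty_iff_deriv.1 hf).2.differentiable (by simp)
  have hdp : Differentiable ℝ (pri ℏ s f) :=
    (hdf'.add (differentiable_mulOp hdu hdf)).const_mul (-I * (ℏ : ℂ))
  have key : pri ℏ s (pri ℏ s (mulOp s f)) x =
      (s x : ℂ) * pri ℏ s (pri ℏ s f) x + -I * (ℏ : ℂ) * (2 * ((deriv s x : ℝ) : ℂ) * pri ℏ s f x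
        + -I * (ℏ : ℂ) * ((deriv (deriv s) x : ℝ) : ℂ) * f x) := by
    rw [pri_mulOp ℏ s hds hdf,
      pri_add_smul ℏ s _ (differentiable_mulOp hds hdp) (differentiable_mulOp hdu hdf),
      pri_mulOp ℏ s hds hdp, pri_mulOp ℏ s hdu hdf]
    simp only [mulOp, Pi.add_apply, Pi.smul_apply, smul_eq_mul]
    ring
  have hℏ' : (ℏ : ℂ) ≠ 0 := ofReal_ne_zero.2 hℏ.ne'
  have hm' : (m : ℂ) ≠ 0 := ofReal_ne_zero.2 hm.ne'
  have hpf : pri ℏ s f x = -I * (ℏ : ℂ) * (deriv f x + ((deriv s x : ℝ) : ℂ) * f x) := rfl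
  simp only [QPB, Pi.sub_apply, Hri, key, hpf]
  simp only [mulOp, Hri]
  field_simp
  ring
end
end

section
/- Covariant dynamics of the position for the classical harmonic oscillator: the QCPB satisfies (i/ℏ)·[Ĥ^(cl), x̂] = (1/m)·p̂^(cl) + x̂∘ŵ^(cl), i.e. for every smooth f : ℝ → ℂ and x ∈ ℝ, (i/ℏ)([Ĥ^(cl), x̂]f)(x) = (1/m)(−iℏ f'(x)) + x·(−(iℏ/2m))(2u(x) f'(x) + u'(x) f(x)). -/
noncomputable section
open Complex

theorem deriv_ofReal_mul {g : ℝ → ℝ} {f : ℝ → ℂ} (hg : Differentiable ℝ g)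
    (hf : Differentiable ℝ f) :
    deriv (fun x => (g x : ℂ) * f x)
      = fun x => ((deriv g x : ℝ) : ℂ) * f x + (g x : ℂ) * deriv f x := by
  funext x
  exact ((hg x).hasDerivAt.ofReal_comp.mul (hf x).hasDerivAt).deriv

theorem deriv_deriv_ofReal_mul {g : ℝ → ℝ} {f : ℝ → ℂ} (hg : ContDiff ℝ 2 g)
    (hf : ContDiff ℝ 2 f) (x : ℝ) :
    deriv (deriv fun x => (g x : ℂ) * f x) x
      = ((deriv (deriv g) x : ℝ) : ℂ) * f x + 2 * ((deriv g x : ℝ) : ℂ) * deriv f x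
        + (g x : ℂ) * deriv (deriv f) x := by
  have hg₀ := hg.differentiable (by norm_num)
  have hf₀ := hf.differentiable (by norm_num)
  have hg₁ := hg.differentiable_deriv_two
  have hf₁ := hf.differentiable_deriv_two
  rw [deriv_ofReal_mul hg₀ hf₀]
  have h₁ := (hg₁ x).hasDerivAt.ofReal_comp.mul (hf₀ x).hasDerivAt
  have h₂ := (hg₀ x).hasDerivAt.ofReal_comp.mul (hf₁ x).hasDerivAt
  refine (h₁.add h₂).deriv.trans ?_
  ring

theorem QPB_mulOp_xhat (s : ℝ → ℝ) (f : ℝ → ℂ) : QPB (mulOp s) xhat f = 0 := by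
  funext x
  simp only [QPB, mulOp, xhat, Pi.sub_apply, Pi.zero_apply]
  ring

theorem Hcl_zero (ℏ m ω : ℝ) : Hcl ℏ m ω 0 = 0 := by
  funext x
  simp [Hcl]

/-- Commutator of the Hamiltonian with a multiplication operator. -/
theorem QPB_Hcl_mulOp (ℏ m ω : ℝ) {g : ℝ → ℝ} {f : ℝ → ℂ} (hg : ContDiff ℝ 2 g)
    (hf : ContDiff ℝ 2 f) (x : ℝ) :
    QPB (Hcl ℏ m ω) (mulOp g) f x
      = -((ℏ : ℂ) ^ 2 / (2 * (m : ℂ))) *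
        (2 * ((deriv g x : ℝ) : ℂ) * deriv f x + ((deriv (deriv g) x : ℝ) : ℂ) * f x) := by
  have h : deriv (deriv (mulOp g f)) x = _ := deriv_deriv_ofReal_mul hg hf x
  simp only [QPB, Hcl, Pi.sub_apply, h]
  simp only [mulOp, Hcl]
  ring

/-- Covariant dynamics of the position for the classical harmonic oscillator:
`(i/ℏ)·[Ĥ⁽ᶜˡ⁾, x̂] = (1/m)·p̂⁽ᶜˡ⁾ + x̂∘ŵ⁽ᶜˡ⁾`. -/
theorem covariant_dynamics_position_classical (ℏ m ω : ℝ)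
    (hℏ : 0 < ℏ) (hm : 0 < m) (hω : 0 < ω)
    (s : ℝ → ℝ) (hs : ContDiff ℝ (⊤ : ℕ∞) s) :
    ∀ f : ℝ → ℂ, ContDiff ℝ (⊤ : ℕ∞) f → ∀ x : ℝ,
      (Complex.I / (ℏ : ℂ)) * QCPB s (Hcl ℏ m ω) xhat f x
        = (1 / (m : ℂ)) * (-Complex.I * (ℏ : ℂ) * deriv f x)
          + (x : ℂ) * (-(Complex.I * (ℏ : ℂ) / (2 * (m : ℂ)))) *
              (2 * ((deriv s x : ℝ) : ℂ) * deriv f x + ((deriv (deriv s) x : ℝ) : ℂ) * f x) := by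
  intro f hf x
  have hs₂ : ContDiff ℝ 2 s := contDiff_infty.1 hs 2
  have hf₂ : ContDiff ℝ 2 f := contDiff_infty.1 hf 2
  have hx : QPB (Hcl ℏ m ω) xhat f x = -((ℏ : ℂ) ^ 2 / (2 * (m : ℂ))) * (2 * deriv f x) := by
    have h : QPB (Hcl ℏ m ω) xhat f x = _ := QPB_Hcl_mulOp ℏ m ω contDiff_id hf₂ x
    simpa using h
  have hsH : QPB (mulOp s) (Hcl ℏ m ω) f x = -QPB (Hcl ℏ m ω) (mulOp s) f x := by
    simp [QPB]
  have hℏ₀ : (ℏ : ℂ) ≠ 0 := by exact_mod_cast hℏ.ne'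
  have hm₀ : (m : ℂ) ≠ 0 := by exact_mod_cast hm.ne'
  have hQ : QCPB s (Hcl ℏ m ω) xhat f x
      = QPB (Hcl ℏ m ω) xhat f x + (x : ℂ) * QPB (Hcl ℏ m ω) (mulOp s) f x := by
    simp only [QCPB, QPB_mulOp_xhat, Hcl_zero, Pi.sub_apply, Pi.add_apply, Pi.zero_apply]
    simp only [xhat, hsH]
    ring
  rw [hQ, hx, QPB_Hcl_mulOp ℏ m ω hs₂ hf₂]
  field_simp
end
end

section
/- Covariant dynamics of the momentum for the classical harmonic oscillator: the QCPB satisfies (i/ℏ)·[Ĥ^(cl), p̂^(cl)] = −mω²·x̂ − Ĥ^(cl)∘u + p̂^(cl)∘ŵ^(cl), as an identity of operators applied to every smooth f : ℝ → ℂ, where u denotes the multiplication operator by u. -/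
noncomputable section
open Complex

theorem Hcl_smul (ℏ m ω : ℝ) (c : ℂ) (g : ℝ → ℂ) :
    Hcl ℏ m ω (c • g) = c • Hcl ℏ m ω g := by
  have h : deriv (c • g) = c • deriv g := funext fun _ => deriv_const_smul_field c g
  funext x
  simp only [Hcl, h, deriv_const_smul_field, Pi.smul_apply, smul_eq_mul]
  ring

theorem pcl_smul (ℏ : ℝ) (c : ℂ) (g : ℝ → ℂ) : pcl ℏ (c • g) = c • pcl ℏ g := by
  funext x
  simp only [pcl, deriv_const_smul_field, Pi.smul_apply, smul_eq_mul]
  ring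

theorem hasDerivAt_mulOp {g : ℝ → ℝ} {f : ℝ → ℂ} (hg : Differentiable ℝ g)
    (hf : Differentiable ℝ f) (x : ℝ) :
    HasDerivAt (mulOp g f) (mulOp (deriv g) f x + mulOp g (deriv f) x) x :=
  (hg x).hasDerivAt.ofReal_comp.mul (hf x).hasDerivAt

theorem QPB_mulOp_pcl (ℏ : ℝ) {s : ℝ → ℝ} {f : ℝ → ℂ} (hs : Differentiable ℝ s)
    (hf : Differentiable ℝ f) :
    QPB (mulOp s) (pcl ℏ) f = (I * (ℏ : ℂ)) • mulOp (deriv s) f := by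
  funext x
  simp only [QPB, pcl, Pi.sub_apply, Pi.smul_apply, smul_eq_mul,
    (hasDerivAt_mulOp hs hf x).deriv]
  simp only [mulOp, pcl]
  ring

theorem QPB_mulOp_Hcl (ℏ m ω : ℝ) {s : ℝ → ℝ} {f : ℝ → ℂ} (hs : Differentiable ℝ s)
    (hs' : Differentiable ℝ (deriv s)) (hf : Differentiable ℝ f)
    (hf' : Differentiable ℝ (deriv f)) :
    QPB (mulOp s) (Hcl ℏ m ω) f = (I * (ℏ : ℂ)) • wcl ℏ m s f := by
  have h : deriv (mulOp s f) = mulOp (deriv s) f + mulOp s (deriv f) :=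
    funext fun x => (hasDerivAt_mulOp hs hf x).deriv
  funext x
  have h' := ((hasDerivAt_mulOp hs' hf x).add (hasDerivAt_mulOp hs hf' x)).deriv
  simp only [QPB, Hcl, wcl, Pi.sub_apply, Pi.smul_apply, smul_eq_mul, h, h']
  simp only [mulOp, Hcl]
  linear_combination ((ℏ : ℂ) ^ 2 / (2 * (m : ℂ))) *
    (2 * ((deriv s x : ℝ) : ℂ) * deriv f x + ((deriv (deriv s) x : ℝ) : ℂ) * f x) * I_sq

theorem QPB_Hcl_pcl (ℏ m ω : ℝ) {f : ℝ → ℂ} (hf : Differentiable ℝ f)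
    (hf'' : Differentiable ℝ (deriv (deriv f))) :
    QPB (Hcl ℏ m ω) (pcl ℏ) f = (I * (ℏ : ℂ) * ((m : ℂ) * (ω : ℂ) ^ 2)) • xhat f := by
  have hp : pcl ℏ f = (-I * (ℏ : ℂ)) • deriv f := rfl
  funext x
  have hH := ((hf'' x).hasDerivAt.const_mul (-((ℏ : ℂ) ^ 2 / (2 * (m : ℂ))))).add
    ((((hasDerivAt_id x).ofReal_comp.pow 2).const_mul ((m : ℂ) * (ω : ℂ) ^ 2 / 2)).mul
      (hf x).hasDerivAt)
  have hH' : deriv (Hcl ℏ m ω f) x = _ := hH.deriv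
  simp only [QPB, hp, Hcl_smul, Pi.sub_apply, Pi.smul_apply, smul_eq_mul]
  simp only [pcl, hH']
  simp [Hcl, xhat]
  ring


/-- Covariant dynamics of the momentum for the classical harmonic oscillator:
`(i/ℏ)·[Ĥ⁽ᶜˡ⁾, p̂⁽ᶜˡ⁾] = −mω²·x̂ − Ĥ⁽ᶜˡ⁾∘u + p̂⁽ᶜˡ⁾∘ŵ⁽ᶜˡ⁾`. -/
theorem covariant_dynamics_momentum_classical (ℏ m ω : ℝ)
    (hℏ : 0 < ℏ) (hm : 0 < m) (hω : 0 < ω)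
    (s : ℝ → ℝ) (hs : ContDiff ℝ (⊤ : ℕ∞) s) :
    ∀ f : ℝ → ℂ, ContDiff ℝ (⊤ : ℕ∞) f → ∀ x : ℝ,
      (Complex.I / (ℏ : ℂ)) * QCPB s (Hcl ℏ m ω) (pcl ℏ) f x
        = -((m : ℂ) * (ω : ℂ) ^ 2) * ((x : ℂ) * f x)
          - Hcl ℏ m ω (mulOp (deriv s) f) x
          + pcl ℏ (wcl ℏ m s f) x := by
  intro f hf x
  have hs₀ : Differentiable ℝ s := hs.differentiable (by simp)
  have hs₁ : ContDiff ℝ (⊤ : ℕ∞) (deriv s) := (contDiff_infty_iff_deriv.1 hs).2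
  have hf₀ : Differentiable ℝ f := hf.differentiable (by simp)
  have hf₁ : ContDiff ℝ (⊤ : ℕ∞) (deriv f) := (contDiff_infty_iff_deriv.1 hf).2
  have hf₂ : ContDiff ℝ (⊤ : ℕ∞) (deriv (deriv f)) := (contDiff_infty_iff_deriv.1 hf₁).2
  have hℏ' : (ℏ : ℂ) ≠ 0 := ofReal_ne_zero.2 hℏ.ne'
  have hI : I / (ℏ : ℂ) * (I * (ℏ : ℂ)) = -1 := by
    field_simp
    exact I_sq
  simp only [QCPB, QPB_mulOp_pcl ℏ hs₀ hf₀,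
    QPB_mulOp_Hcl ℏ m ω hs₀ (hs₁.differentiable (by simp)) hf₀ (hf₁.differentiable (by simp)),
    QPB_Hcl_pcl ℏ m ω hf₀ (hf₂.differentiable (by simp)),
    Hcl_smul, pcl_smul, Pi.add_apply, Pi.sub_apply, Pi.smul_apply, smul_eq_mul, xhat]
  linear_combination ((m : ℂ) * (ω : ℂ) ^ 2 * ((x : ℂ) * f x)
    + Hcl ℏ m ω (mulOp (deriv s) f) x - pcl ℏ (wcl ℏ m s f) x) * hI
end
end

section
/- Covariant dynamics of the geomentum for the generalized (Ri) harmonic oscillator: the QCPB satisfies (i/ℏ)·[Ĥ^(ri), p̂^(ri)] = −mω²·x̂ − Ĥ^(ri)∘u + p̂^(ri)∘ŵ^(ri), as an identity of operators applied to every smooth f : ℝ → ℂ, where u denotes the multiplication operator by u. -/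
noncomputable section
open Complex

theorem deriv_mulOp {g : ℝ → ℝ} {f : ℝ → ℂ} {x : ℝ} (hg : DifferentiableAt ℝ g x)
    (hf : DifferentiableAt ℝ f x) :
    deriv (mulOp g f) x = ((deriv g x : ℝ) : ℂ) * f x + (g x : ℂ) * deriv f x :=
  (hg.hasDerivAt.ofReal_comp.mul hf.hasDerivAt).deriv

theorem pri_const_smul (ℏ : ℝ) (s : ℝ → ℝ) (c : ℂ) (f : ℝ → ℂ) :
    pri ℏ s (c • f) = c • pri ℏ s f := by
  funext x
  simp only [pri, Pi.smul_apply, smul_eq_mul, deriv_const_smul_field]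
  ring

theorem pri_add (ℏ : ℝ) (s : ℝ → ℝ) {f g : ℝ → ℂ} (hf : Differentiable ℝ f)
    (hg : Differentiable ℝ g) : pri ℏ s (f + g) = pri ℏ s f + pri ℏ s g := by
  funext x
  simp only [pri, Pi.add_apply, deriv_add (hf x) (hg x)]
  ring

theorem contDiff_deriv_top {E : Type*} [NormedAddCommGroup E] [NormedSpace ℝ E] {f : ℝ → E}
    (hf : ContDiff ℝ (⊤ : ℕ∞) f) : ContDiff ℝ (⊤ : ℕ∞) (deriv f) :=
  (contDiff_infty_iff_deriv.1 hf).2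

theorem contDiff_mulOp {g : ℝ → ℝ} {f : ℝ → ℂ} (hg : ContDiff ℝ (⊤ : ℕ∞) g)
    (hf : ContDiff ℝ (⊤ : ℕ∞) f) : ContDiff ℝ (⊤ : ℕ∞) (mulOp g f) :=
  (ofRealCLM.contDiff.comp hg).mul hf

theorem contDiff_pri (ℏ : ℝ) {s : ℝ → ℝ} {f : ℝ → ℂ} (hs : ContDiff ℝ (⊤ : ℕ∞) s)
    (hf : ContDiff ℝ (⊤ : ℕ∞) f) : ContDiff ℝ (⊤ : ℕ∞) (pri ℏ s f) :=
  contDiff_const.mul ((contDiff_deriv_top hf).add (contDiff_mulOp (contDiff_deriv_top hs) hf))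

theorem Hri_eq (ℏ m ω : ℝ) (s : ℝ → ℝ) (f : ℝ → ℂ) :
    Hri ℏ m ω s f = (1 / (2 * (m : ℂ))) • pri ℏ s (pri ℏ s f)
      + ((m : ℂ) * (ω : ℂ) ^ 2 / 2) • mulOp (fun x => x ^ 2) f := by
  funext x
  simp only [Hri, mulOp, Pi.add_apply, Pi.smul_apply, smul_eq_mul, ofReal_pow]
  ring

theorem Hri_const_smul (ℏ m ω : ℝ) (s : ℝ → ℝ) (c : ℂ) (f : ℝ → ℂ) :
    Hri ℏ m ω s (c • f) = c • Hri ℏ m ω s f := by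
  funext x
  simp only [Hri, pri_const_smul, Pi.smul_apply, smul_eq_mul]
  ring

theorem QPB_mulOp_pri (ℏ : ℝ) (s : ℝ → ℝ) {g : ℝ → ℝ} {f : ℝ → ℂ} (hg : Differentiable ℝ g)
    (hf : Differentiable ℝ f) :
    QPB (mulOp g) (pri ℏ s) f = (I * (ℏ : ℂ)) • mulOp (deriv g) f := by
  rw [QPB, pri_mulOp ℏ s hg hf, sub_add_cancel_left, ← neg_smul, neg_mul, neg_neg]

theorem QPB_mulOp_Hri (ℏ m ω : ℝ) {s : ℝ → ℝ} {f : ℝ → ℂ} (hs : ContDiff ℝ (⊤ : ℕ∞) s)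
    (hf : ContDiff ℝ (⊤ : ℕ∞) f) :
    QPB (mulOp s) (Hri ℏ m ω s) f = (I * (ℏ : ℂ)) • wri ℏ m s f := by
  have htop : ((⊤ : ℕ∞) : WithTop ℕ∞) ≠ 0 := by simp
  have hu := contDiff_deriv_top hs
  have hp := contDiff_pri ℏ hs hf
  have key : pri ℏ s (pri ℏ s (mulOp s f)) = mulOp s (pri ℏ s (pri ℏ s f))
      + (-I * (ℏ : ℂ)) • mulOp (deriv s) (pri ℏ s f)
      + (-I * (ℏ : ℂ)) • (mulOp (deriv s) (pri ℏ s f)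
        + (-I * (ℏ : ℂ)) • mulOp (deriv (deriv s)) f) := by
    rw [pri_mulOp ℏ s (hs.differentiable htop) (hf.differentiable htop),
      pri_add ℏ s ((contDiff_mulOp hs hp).differentiable htop)
        (((contDiff_mulOp hu hf).differentiable htop).const_smul _),
      pri_const_smul, pri_mulOp ℏ s (hs.differentiable htop) (hp.differentiable htop),
      pri_mulOp ℏ s (hu.differentiable htop) (hf.differentiable htop)]
  funext x
  simp only [QPB, Hri_eq, key, Pi.sub_apply, Pi.add_apply, Pi.smul_apply, smul_eq_mul, mulOp, wri]
  simp only [pri]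
  ring

theorem QPB_Hri_pri (ℏ m ω : ℝ) {s : ℝ → ℝ} {f : ℝ → ℂ} (hs : ContDiff ℝ (⊤ : ℕ∞) s)
    (hf : ContDiff ℝ (⊤ : ℕ∞) f) :
    QPB (Hri ℏ m ω s) (pri ℏ s) f = (I * (ℏ : ℂ) * ((m : ℂ) * (ω : ℂ) ^ 2)) • xhat f := by
  have htop : ((⊤ : ℕ∞) : WithTop ℕ∞) ≠ 0 := by simp
  have hsq : ContDiff ℝ (⊤ : ℕ∞) (fun x : ℝ => x ^ 2) := contDiff_id.pow 2
  have hpp := contDiff_pri ℏ hs (contDiff_pri ℏ hs hf)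
  rw [QPB, Hri_eq, Hri_eq, pri_add ℏ s ((hpp.differentiable htop).const_smul _)
      (((contDiff_mulOp hsq hf).differentiable htop).const_smul _), pri_const_smul,
    pri_const_smul, pri_mulOp ℏ s (hsq.differentiable htop) (hf.differentiable htop)]
  funext x
  simp [mulOp, xhat]
  ring

/-- Covariant dynamics of the geomentum for the generalized (Ri) harmonic oscillator:
`(i/ℏ)·[Ĥ⁽ʳⁱ⁾, p̂⁽ʳⁱ⁾] = −mω²·x̂ − Ĥ⁽ʳⁱ⁾∘u + p̂⁽ʳⁱ⁾∘ŵ⁽ʳⁱ⁾`. -/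
theorem covariant_dynamics_momentum_ri (ℏ m ω : ℝ)
    (hℏ : 0 < ℏ) (hm : 0 < m) (hω : 0 < ω)
    (s : ℝ → ℝ) (hs : ContDiff ℝ (⊤ : ℕ∞) s) :
    ∀ f : ℝ → ℂ, ContDiff ℝ (⊤ : ℕ∞) f → ∀ x : ℝ,
      (Complex.I / (ℏ : ℂ)) * QCPB s (Hri ℏ m ω s) (pri ℏ s) f x
        = -((m : ℂ) * (ω : ℂ) ^ 2) * ((x : ℂ) * f x)
          - Hri ℏ m ω s (mulOp (deriv s) f) x
          + pri ℏ s (wri ℏ m s f) x := by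
  intro f hf x
  have htop : ((⊤ : ℕ∞) : WithTop ℕ∞) ≠ 0 := by simp
  have hℏ' : (ℏ : ℂ) ≠ 0 := ofReal_ne_zero.2 hℏ.ne'
  have hI : I / (ℏ : ℂ) * (I * (ℏ : ℂ)) = -1 := by
    field_simp
    exact I_sq
  simp only [QCPB, QPB_Hri_pri ℏ m ω hs hf, QPB_mulOp_Hri ℏ m ω hs hf,
    QPB_mulOp_pri ℏ s (hs.differentiable htop) (hf.differentiable htop), Hri_const_smul,
    pri_const_smul, Pi.sub_apply, Pi.add_apply, Pi.smul_apply, smul_eq_mul, xhat]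
  linear_combination ((m : ℂ) * (ω : ℂ) ^ 2 * ((x : ℂ) * f x)
    + Hri ℏ m ω s (mulOp (deriv s) f) x - pri ℏ s (wri ℏ m s f) x) * hI
end
end

section
/- With the geometric annihilation operator a^(s) = a + b and geometric creation operator a^(s)† = a† − b, one has a^(s)†∘a^(s) = (mω/2ℏ)x² − (ℏ/2mω)·D²/dx² − 1/2, where D²/dx² is the operator f ↦ f'' + u² f + 2u f' + u' f; that is, for every smooth f : ℝ → ℂ, a^(s)†(a^(s) f) = (mω/2ℏ)x² f − (ℏ/2mω)(f'' + u² f + 2u f' + u' f) − f/2. -/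
noncomputable section
open Complex

/-- The two normalisations are related by `√(ℏ/2mω) = √(mω/2ℏ) · ℏ/mω`. -/
theorem sqrt_hbar_div_eq_mul {ℏ m ω : ℝ} (hℏ : 0 < ℏ) (hm : 0 < m) (hω : 0 < ω) :
    Real.sqrt (ℏ / (2 * m * ω)) = Real.sqrt (m * ω / (2 * ℏ)) * (ℏ / (m * ω)) := by
  have hk : 0 ≤ ℏ / (m * ω) := by positivity
  rw [show Real.sqrt (m * ω / (2 * ℏ)) * (ℏ / (m * ω)) =
    Real.sqrt (m * ω / (2 * ℏ)) * Real.sqrt ((ℏ / (m * ω)) ^ 2) by rw [Real.sqrt_sq hk], ← Real.sqrt_mul (by positivity)]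
  congr 1
  field_simp

theorem asOp_eq {ℏ m ω : ℝ} (hℏ : 0 < ℏ) (hm : 0 < m) (hω : 0 < ω) (s : ℝ → ℝ)
    (f : ℝ → ℂ) :
    asOp ℏ m ω s f = fun x : ℝ => (Real.sqrt (m * ω / (2 * ℏ)) : ℂ) *
      ((x : ℂ) * f x + ((ℏ : ℂ) / ((m : ℂ) * (ω : ℂ))) *
        (deriv f x + ((deriv s x : ℝ) : ℂ) * f x)) := by
  funext x
  simp only [asOp, aOp, bOp, mulOp, sqrt_hbar_div_eq_mul hℏ hm hω]
  push_cast
  ring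

theorem adsOp_eq {ℏ m ω : ℝ} (hℏ : 0 < ℏ) (hm : 0 < m) (hω : 0 < ω) (s : ℝ → ℝ)
    (f : ℝ → ℂ) :
    adsOp ℏ m ω s f = fun x : ℝ => (Real.sqrt (m * ω / (2 * ℏ)) : ℂ) *
      ((x : ℂ) * f x - ((ℏ : ℂ) / ((m : ℂ) * (ω : ℂ))) *
        (deriv f x + ((deriv s x : ℝ) : ℂ) * f x)) := by
  funext x
  simp only [adsOp, adOp, bOp, mulOp, sqrt_hbar_div_eq_mul hℏ hm hω]
  push_cast
  ring

theorem ContDiff.hasDerivAt_deriv {E : Type*} [NormedAddCommGroup E] [NormedSpace ℝ E]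
    {f : ℝ → E} (hf : ContDiff ℝ 2 f) (x : ℝ) :
    HasDerivAt (deriv f) (deriv (deriv f) x) x :=
  (hf.differentiable_deriv_two x).hasDerivAt

/-- `a⁽ˢ⁾†∘a⁽ˢ⁾ = (mω/2ℏ)x² − (ℏ/2mω)·D²/dx² − 1/2`, where
`D²/dx² f = f'' + u² f + 2u f' + u' f`. -/
theorem geometric_ladder_product (ℏ m ω : ℝ)
    (hℏ : 0 < ℏ) (hm : 0 < m) (hω : 0 < ω)
    (s : ℝ → ℝ) (hs : ContDiff ℝ (⊤ : ℕ∞) s) :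
    ∀ f : ℝ → ℂ, ContDiff ℝ (⊤ : ℕ∞) f → ∀ x : ℝ,
      adsOp ℏ m ω s (asOp ℏ m ω s f) x
        = ((m : ℂ) * (ω : ℂ) / (2 * (ℏ : ℂ))) * (x : ℂ) ^ 2 * f x
          - ((ℏ : ℂ) / (2 * (m : ℂ) * (ω : ℂ))) *
              (deriv (deriv f) x + ((deriv s x : ℝ) : ℂ) ^ 2 * f x
                + 2 * ((deriv s x : ℝ) : ℂ) * deriv f x + ((deriv (deriv s) x : ℝ) : ℂ) * f x)
          - f x / 2 := by
  intro f hf x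
  have hf2 : ContDiff ℝ 2 f := hf.of_le (WithTop.coe_le_coe.2 le_top)
  have hs2 : ContDiff ℝ 2 s := hs.of_le (WithTop.coe_le_coe.2 le_top)
  have hf₀ : HasDerivAt f (deriv f x) x :=
    (hf2.differentiable (by norm_num) x).hasDerivAt
  have hd := ((((hasDerivAt_id x).ofReal_comp.mul hf₀).add
    ((hf2.hasDerivAt_deriv x).add
      ((hs2.hasDerivAt_deriv x).ofReal_comp.mul hf₀) |>.const_mul
        ((ℏ : ℂ) / ((m : ℂ) * (ω : ℂ)))))).const_mul
    (Real.sqrt (m * ω / (2 * ℏ)) : ℂ)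
  have hα : (Real.sqrt (m * ω / (2 * ℏ)) : ℂ) ^ 2 = (m : ℂ) * ω / (2 * ℏ) := by
    exact_mod_cast Real.sq_sqrt (show 0 ≤ m * ω / (2 * ℏ) by positivity)
  have hm' : (m : ℂ) ≠ 0 := by exact_mod_cast hm.ne'
  have hω' : (ω : ℂ) ≠ 0 := by exact_mod_cast hω.ne'
  have hℏ' : (ℏ : ℂ) ≠ 0 := by exact_mod_cast hℏ.ne'
  rw [adsOp_eq hℏ hm hω, asOp_eq hℏ hm hω]
  beta_reduce
  erw [hd.deriv]
  simp only [id, Complex.ofReal_one]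
  generalize (Real.sqrt (m * ω / (2 * ℏ)) : ℂ) = α at hα ⊢
  trans α ^ 2 * ((x : ℂ) ^ 2 * f x - (ℏ : ℂ) / (m * ω) * f x
    - ((ℏ : ℂ) / (m * ω)) ^ 2 * (deriv (deriv f) x + ((deriv s x : ℝ) : ℂ) ^ 2 * f x
      + 2 * ((deriv s x : ℝ) : ℂ) * deriv f x + ((deriv (deriv s) x : ℝ) : ℂ) * f x))
  · ring
  · rw [hα]
    field_simp
    ring
end
end

section
/- The Ri-operator Hamiltonian satisfies Ĥ^(ri) = ℏω(N̂^(r) + 1/2), where N̂^(r) = a^(s)†∘a^(s) with a^(s) = a + b and a^(s)† = a† − b; that is, for every smooth f : ℝ → ℂ, (1/2m) p̂^(ri)(p̂^(ri) f) + (mω²/2)x² f = ℏω·(a^(s)†(a^(s) f) + f/2). -/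
noncomputable section
open Complex

/-- `√(ℏ/2mω)` is the coefficient of the derivative in the ladder operators. -/
lemma sqrt_div_two_mul_mul (ℏ m ω : ℝ) (hℏ : 0 < ℏ) (hm : 0 < m) (hω : 0 < ω) :
    Real.sqrt (ℏ / (2 * m * ω)) = Real.sqrt (m * ω / (2 * ℏ)) * (ℏ / (m * ω)) := by
  have h : ℏ / (2 * m * ω) = m * ω / (2 * ℏ) * (ℏ / (m * ω)) ^ 2 := by
    field_simp
  rw [h, Real.sqrt_mul (by positivity), Real.sqrt_sq (by positivity)]

/-- `a⁽ˢ⁾ = √(mω/2ℏ) (x + (ℏ/mω)(d/dx + u))`. -/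
lemma asOp_apply (ℏ m ω : ℝ) (hℏ : 0 < ℏ) (hm : 0 < m) (hω : 0 < ω) (s : ℝ → ℝ)
    (f : ℝ → ℂ) (x : ℝ) :
    asOp ℏ m ω s f x = (Real.sqrt (m * ω / (2 * ℏ)) : ℂ) * ((x : ℂ) * f x
      + ((ℏ : ℂ) / ((m : ℂ) * (ω : ℂ))) * (deriv f x + ((deriv s x : ℝ) : ℂ) * f x)) := by
  simp only [asOp, aOp, bOp, mulOp, sqrt_div_two_mul_mul ℏ m ω hℏ hm hω]
  push_cast
  ring

/-- `a⁽ˢ⁾† = √(mω/2ℏ) (x - (ℏ/mω)(d/dx + u))`. -/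
lemma adsOp_apply (ℏ m ω : ℝ) (hℏ : 0 < ℏ) (hm : 0 < m) (hω : 0 < ω) (s : ℝ → ℝ)
    (f : ℝ → ℂ) (x : ℝ) :
    adsOp ℏ m ω s f x = (Real.sqrt (m * ω / (2 * ℏ)) : ℂ) * ((x : ℂ) * f x
      - ((ℏ : ℂ) / ((m : ℂ) * (ω : ℂ))) * (deriv f x + ((deriv s x : ℝ) : ℂ) * f x)) := by
  simp only [adsOp, adOp, bOp, mulOp, sqrt_div_two_mul_mul ℏ m ω hℏ hm hω]
  push_cast
  ring

/-- The Ri-operator Hamiltonian satisfies `Ĥ⁽ʳⁱ⁾ = ℏω(N̂⁽ʳ⁾ + 1/2)` with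
`N̂⁽ʳ⁾ = a⁽ˢ⁾†∘a⁽ˢ⁾`. -/
theorem ri_hamiltonian_ladder (ℏ m ω : ℝ)
    (hℏ : 0 < ℏ) (hm : 0 < m) (hω : 0 < ω)
    (s : ℝ → ℝ) (hs : ContDiff ℝ (⊤ : ℕ∞) s) :
    ∀ f : ℝ → ℂ, ContDiff ℝ (⊤ : ℕ∞) f → ∀ x : ℝ,
      (1 / (2 * (m : ℂ))) * pri ℏ s (pri ℏ s f) x
          + ((m : ℂ) * (ω : ℂ) ^ 2 / 2) * (x : ℂ) ^ 2 * f x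
        = (ℏ : ℂ) * (ω : ℂ) * (adsOp ℏ m ω s (asOp ℏ m ω s f) x + f x / 2) := by
  intro f hf x
  have hu : Differentiable ℝ (deriv s) :=
    ((contDiff_infty_iff_deriv.mp hs).2).differentiable (by simp)
  have hf' : Differentiable ℝ (deriv f) :=
    ((contDiff_infty_iff_deriv.mp hf).2).differentiable (by simp)
  have hfx : HasDerivAt f (deriv f x) x := (hf.differentiable (by simp) x).hasDerivAt
  set F : ℝ → ℂ := fun y => deriv f y + ((deriv s y : ℝ) : ℂ) * f y with hF
  have hFx : HasDerivAt F (deriv F x) x := by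
    have hF' := (hf' x).hasDerivAt.add ((hu x).hasDerivAt.ofReal_comp.mul hfx)
    exact hF'.differentiableAt.hasDerivAt
  have hpri : pri ℏ s f = fun y => -Complex.I * (ℏ : ℂ) * F y := rfl
  have has : asOp ℏ m ω s f = fun y : ℝ => (Real.sqrt (m * ω / (2 * ℏ)) : ℂ) *
      ((y : ℂ) * f y + ((ℏ : ℂ) / ((m : ℂ) * (ω : ℂ))) * F y) :=
    funext (asOp_apply ℏ m ω hℏ hm hω s f)
  have hdpri := (hFx.const_mul (-Complex.I * (ℏ : ℂ))).deriv
  have hdas := ((((hasDerivAt_id x).ofReal_comp.mul hfx).add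
    (hFx.const_mul ((ℏ : ℂ) / ((m : ℂ) * (ω : ℂ))))).const_mul
      (Real.sqrt (m * ω / (2 * ℏ)) : ℂ)).deriv
  have hdas' : deriv (asOp ℏ m ω s f) x = (Real.sqrt (m * ω / (2 * ℏ)) : ℂ) *
      (f x + (x : ℂ) * deriv f x + ((ℏ : ℂ) / ((m : ℂ) * (ω : ℂ))) * deriv F x) := by
    rw [has]
    refine Eq.trans hdas ?_
    simp
  have hsq : (Real.sqrt (m * ω / (2 * ℏ)) : ℂ) ^ 2 = (m : ℂ) * ω / (2 * ℏ) := by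
    rw [← Complex.ofReal_pow, Real.sq_sqrt (by positivity)]
    push_cast
    rfl
  have hFv : deriv f x = F x - ((deriv s x : ℝ) : ℂ) * f x := by simp [hF]
  have hℏ0 : (ℏ : ℂ) ≠ 0 := by exact_mod_cast hℏ.ne'
  have hm0 : (m : ℂ) ≠ 0 := by exact_mod_cast hm.ne'
  have hω0 : (ω : ℂ) ≠ 0 := by exact_mod_cast hω.ne'
  rw [adsOp_apply ℏ m ω hℏ hm hω, hdas', has, hpri]
  simp only [pri]
  rw [hdpri, hFv]
  generalize (Real.sqrt (m * ω / (2 * ℏ)) : ℂ) = c at hsq ⊢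
  generalize F x = v
  generalize deriv F x = w
  generalize ((deriv s x : ℝ) : ℂ) = u
  generalize f x = y
  trans (ℏ : ℂ) * ω * (c ^ 2 * ((x : ℂ) ^ 2 * y - (ℏ / (m * ω)) * y
    - (ℏ / (m * ω)) ^ 2 * (w + u * v)) + y / 2)
  · rw [hsq]
    field_simp
    ring_nf
    simp only [Complex.I_sq]
    ring
  · ring
end
end
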